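/- (No Picard space) Let s₁, s₂ ∈ ℝ, −1 ≤ α < 0, and T > 0. There does not exist a Banach space X_T continuously embedded in C([−T,T]; H^{s₁,s₂}(ℝ²)) together with a constant C such that both ‖W_α(·)φ‖_{X_T} ≤ C‖φ‖_{H^{s₁,s₂}} for all φ ∈ H^{s₁,s₂} and ‖∫₀^t W_α(t−t') u(t')∂_x u(t') dt'‖_{X_T} ≤ C‖u‖²_{X_T} for all u ∈ X_T. -/

import Mathlib

open MeasureTheory Filter
open scoped ENNReal

noncomputable section

/-- Fourier transform on ℝ². -/
def FT2 (f : ℝ × ℝ → ℂ) : ℝ × ℝ → ℂ := fun p =>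
  ∫ q : ℝ × ℝ, Complex.exp (-((2 * Real.pi * (p.1 * q.1 + p.2 * q.2) : ℝ) : ℂ) * Complex.I) * f q

/-- Inverse Fourier transform on ℝ². -/
def IFT2 (f : ℝ × ℝ → ℂ) : ℝ × ℝ → ℂ := fun x =>
  ∫ p : ℝ × ℝ, Complex.exp (((2 * Real.pi * (x.1 * p.1 + x.2 * p.2) : ℝ) : ℂ) * Complex.I) * f p

/-- Homogeneous fractional derivative in `x`, symbol `|ξ|^s`. -/
def Dx (s : ℝ) (f : ℝ × ℝ → ℂ) : ℝ × ℝ → ℂ :=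
  IFT2 fun p => ((|p.1| ^ s : ℝ) : ℂ) * FT2 f p

/-- Fractional derivative in `x` with complex order `β`. -/
def DxC (β : ℂ) (f : ℝ × ℝ → ℂ) : ℝ × ℝ → ℂ :=
  IFT2 fun p => (((|p.1| : ℝ) : ℂ) ^ β) * FT2 f p

/-- Inhomogeneous derivative `J_x^s = (1+|D_x|²)^{s/2}`. -/
def Jx (s : ℝ) (f : ℝ × ℝ → ℂ) : ℝ × ℝ → ℂ :=
  IFT2 fun p => (((1 + p.1 ^ 2) ^ (s / 2) : ℝ) : ℂ) * FT2 f p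

/-- Real-valued version of `J_x^s`. -/
def JxR (s : ℝ) (f : ℝ × ℝ → ℝ) : ℝ × ℝ → ℝ := fun z =>
  (Jx s (fun w => ((f w : ℝ) : ℂ)) z).re

/-- The unitary group `W_α(t)` with symbol `e^{-it(ξ³+sgn(ξ)|ξ|^α η²)}`. -/
def Wgrp (α t : ℝ) (f : ℝ × ℝ → ℂ) : ℝ × ℝ → ℂ :=
  IFT2 fun p =>
    Complex.exp (-Complex.I * (t : ℂ) *
      ((p.1 ^ 3 + Real.sign p.1 * |p.1| ^ α * p.2 ^ 2 : ℝ) : ℂ)) * FT2 f p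

/-- The operator `ℋ D_x^α` (Hilbert transform composed with fractional derivative in `x`). -/
def HDa (α : ℝ) (f : ℝ × ℝ → ℂ) : ℝ × ℝ → ℂ :=
  IFT2 fun p => (-Complex.I) * ((Real.sign p.1 * |p.1| ^ α : ℝ) : ℂ) * FT2 f p

/-- Anisotropic Sobolev norm of `H^{s₁,s₂}(ℝ²)`. -/
def HNorm2 (s₁ s₂ : ℝ) (f : ℝ × ℝ → ℂ) : ℝ :=
  Real.sqrt (∫ p : ℝ × ℝ, ((1 + p.1 ^ 2) ^ s₁ + (1 + p.2 ^ 2) ^ s₂) * ‖FT2 f p‖ ^ 2)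

/-- Membership in the anisotropic Sobolev space `H^{s₁,s₂}(ℝ²)`. -/
def MemH (s₁ s₂ : ℝ) (f : ℝ × ℝ → ℂ) : Prop :=
  Integrable (fun p : ℝ × ℝ => ((1 + p.1 ^ 2) ^ s₁ + (1 + p.2 ^ 2) ^ s₂) * ‖FT2 f p‖ ^ 2) volume

/-- Homogeneous anisotropic Sobolev norm. -/
def HdotNorm (s₁ s₂ : ℝ) (f : ℝ × ℝ → ℂ) : ℝ :=
  Real.sqrt (∫ p : ℝ × ℝ, (|p.1| ^ (2 * s₁) + |p.2| ^ (2 * s₂)) * ‖FT2 f p‖ ^ 2)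

/-- `u` solves `u_t = u_{xxx} - ℋ D_x^α u_{yy} + u u_x` (complex-valued version). -/
def IsSol (α : ℝ) (u : ℝ → ℝ × ℝ → ℂ) : Prop :=
  ∀ t : ℝ, ∀ z : ℝ × ℝ,
    HasDerivAt (fun s => u s z)
      (iteratedDeriv 3 (fun a => u t (a, z.2)) z.1
        - HDa α (fun w => iteratedDeriv 2 (fun b => u t (w.1, b)) w.2) z
        + u t z * deriv (fun a => u t (a, z.2)) z.1) t

/-- `u` solves `u_t = u_{xxx} - ℋ D_x^α u_{yy} + u u_x` (real-valued version). -/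
def IsSolR (α : ℝ) (u : ℝ → ℝ × ℝ → ℝ) : Prop :=
  ∀ t : ℝ, ∀ z : ℝ × ℝ,
    HasDerivAt (fun s => u s z)
      (iteratedDeriv 3 (fun a => u t (a, z.2)) z.1
        - (HDa α (fun w => ((iteratedDeriv 2 (fun b => u t (w.1, b)) w.2 : ℝ) : ℂ)) z).re
        + u t z * deriv (fun a => u t (a, z.2)) z.1) t

/-- `u` solves the equation on the time interval `[0,T]` (real-valued version). -/
def IsSolROn (α T : ℝ) (u : ℝ → ℝ × ℝ → ℝ) : Prop :=
  ∀ t ∈ Set.Icc (0 : ℝ) T, ∀ z : ℝ × ℝ,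
    HasDerivAt (fun s => u s z)
      (iteratedDeriv 3 (fun a => u t (a, z.2)) z.1
        - (HDa α (fun w => ((iteratedDeriv 2 (fun b => u t (w.1, b)) w.2 : ℝ) : ℂ)) z).re
        + u t z * deriv (fun a => u t (a, z.2)) z.1) t

/-- `w` solves the inhomogeneous linear equation `∂_t w = w_{xxx} - ℋ D_x^α w_{yy} + F` on `[0,T]`. -/
def IsSolLin (α T : ℝ) (w F : ℝ → ℝ × ℝ → ℂ) : Prop :=
  ∀ t ∈ Set.Icc (0 : ℝ) T, ∀ z : ℝ × ℝ,
    HasDerivAt (fun s => w s z)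
      (iteratedDeriv 3 (fun a => w t (a, z.2)) z.1
        - HDa α (fun q => iteratedDeriv 2 (fun b => w t (q.1, b)) q.2) z
        + F t z) t


open scoped FourierTransform ContDiff Pointwise

section Fourier

/-- Fourier inversion for test functions on `ℝ²`. -/
theorem FT2_IFT2 {f : ℝ × ℝ → ℂ} (hf : ContDiff ℝ ∞ f) (hs : HasCompactSupport f) :
    FT2 (IFT2 f) = f := by
  set e := WithLp.prodContinuousLinearEquiv 2 ℝ ℝ ℝ with he
  have hcs : HasCompactSupport (f ∘ e) := hs.comp_homeomorph e.toHomeomorph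
  set F := hcs.toSchwartzMap (hf.comp e.contDiff) with hF
  have hFe : ∀ p, F p = f p.ofLp := fun p => rfl
  have mp := WithLp.volume_preserving_ofLp ℝ ℝ
  have me : MeasurableEmbedding (@WithLp.ofLp 2 (ℝ × ℝ)) :=
    (MeasurableEquiv.toLp 2 (ℝ × ℝ)).symm.measurableEmbedding
  have h1 : ∀ x : WithLp 2 (ℝ × ℝ), IFT2 f x.ofLp = 𝓕⁻ (F : WithLp 2 (ℝ × ℝ) → ℂ) x := by
    intro x
    rw [Real.fourierInv_eq']
    unfold IFT2
    rw [← mp.integral_comp me]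
    refine integral_congr_ae (Eventually.of_forall fun v => ?_)
    simp only [hFe, WithLp.prod_inner_apply, smul_eq_mul]
    congr 5
  have h2 : 𝓕 (𝓕⁻ (F : WithLp 2 (ℝ × ℝ) → ℂ)) = F := by
    rw [← SchwartzMap.fourierInv_coe, ← SchwartzMap.fourier_coe]
    simp
  ext x
  have h3 := congrFun h2 (WithLp.toLp 2 x)
  rw [Real.fourier_eq', hFe] at h3
  rw [← h3]
  unfold FT2
  rw [← mp.integral_comp me]
  refine integral_congr_ae (Eventually.of_forall fun v => ?_)
  simp only [h1, WithLp.prod_inner_apply, smul_eq_mul]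
  congr 3
  simp

theorem continuous_character (x : ℝ × ℝ) :
    Continuous fun p : ℝ × ℝ =>
      Complex.exp (((2 * Real.pi * (x.1 * p.1 + x.2 * p.2) : ℝ) : ℂ) * Complex.I) := by
  fun_prop

/-- Differentiation in `x` is multiplication by `2πiξ` on the Fourier side. -/
theorem deriv_IFT2 {f : ℝ × ℝ → ℂ} (hf : Continuous f) (hs : HasCompactSupport f) (w : ℝ × ℝ) :
    deriv (fun a => IFT2 f (a, w.2)) w.1 =
      IFT2 (fun p => 2 * Real.pi * Complex.I * p.1 * f p) w := by
  have key : ∀ (p : ℝ × ℝ) (a : ℝ), HasDerivAt (fun a : ℝ =>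
      Complex.exp (((2 * Real.pi * (a * p.1 + w.2 * p.2) : ℝ) : ℂ) * Complex.I) * f p)
      (Complex.exp (((2 * Real.pi * (a * p.1 + w.2 * p.2) : ℝ) : ℂ) * Complex.I) *
        (2 * Real.pi * Complex.I * p.1 * f p)) a := by
    intro p a
    have h1 : HasDerivAt (fun a : ℝ => 2 * Real.pi * (a * p.1 + w.2 * p.2))
        (2 * Real.pi * p.1) a := by
      have := (((hasDerivAt_id a).mul_const p.1).add_const (w.2 * p.2)).const_mul (2 * Real.pi)
      simpa using this
    have h2 := ((h1.ofReal_comp.mul_const Complex.I).cexp).mul_const (f p)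
    refine h2.congr_deriv ?_
    push_cast
    ring
  have hg : Continuous fun p : ℝ × ℝ => 2 * Real.pi * Complex.I * p.1 * f p := by fun_prop
  have hgs : HasCompactSupport fun p : ℝ × ℝ => 2 * Real.pi * Complex.I * p.1 * f p :=
    hs.mul_left
  have := hasDerivAt_integral_of_dominated_loc_of_deriv_le (μ := (volume : Measure (ℝ × ℝ)))
    (F := fun a p => Complex.exp (((2 * Real.pi * (a * p.1 + w.2 * p.2) : ℝ) : ℂ) * Complex.I)
      * f p)
    (F' := fun a p => Complex.exp (((2 * Real.pi * (a * p.1 + w.2 * p.2) : ℝ) : ℂ) * Complex.I) *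
        (2 * Real.pi * Complex.I * p.1 * f p))
    (x₀ := w.1) (s := Set.univ) (bound := fun p => ‖2 * Real.pi * Complex.I * p.1 * f p‖)
    Filter.univ_mem
    (Eventually.of_forall fun a => (by fun_prop : Continuous _).aestronglyMeasurable)
    ((by fun_prop : Continuous _).integrable_of_hasCompactSupport hs.mul_left)
    ((by fun_prop : Continuous _).aestronglyMeasurable)
    (Eventually.of_forall fun p a _ => by
      rw [norm_mul, Complex.norm_exp_ofReal_mul_I, one_mul])
    (hg.integrable_of_hasCompactSupport hgs).norm
    (Eventually.of_forall fun p a _ => key p a)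
  exact this.2.deriv

/-- The inverse Fourier transform of a convolution is the product. -/
theorem IFT2_mul {f g : ℝ × ℝ → ℂ} (hf : Integrable f) (hg : Integrable g) (z : ℝ × ℝ) :
    IFT2 f z * IFT2 g z = IFT2 (fun p => ∫ q, f q * g (p - q)) z := by
  set e : ℝ × ℝ → ℂ := fun p =>
    Complex.exp (((2 * Real.pi * (z.1 * p.1 + z.2 * p.2) : ℝ) : ℂ) * Complex.I) with he
  have hec : Continuous e := continuous_character z
  have hen : ∀ p, ‖e p‖ ≤ 1 := fun p => by rw [he, Complex.norm_exp_ofReal_mul_I]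
  have headd : ∀ p q, e p = e q * e (p - q) := by
    intro p q
    simp only [he, ← Complex.exp_add]
    congr 1
    simp
    ring
  have hf' : Integrable fun p => e p * f p :=
    hf.bdd_mul hec.aestronglyMeasurable (Eventually.of_forall hen)
  have hg' : Integrable fun p => e p * g p :=
    hg.bdd_mul hec.aestronglyMeasurable (Eventually.of_forall hen)
  have := integral_convolution (μ := (volume : Measure (ℝ × ℝ))) (ν := volume)
    (ContinuousLinearMap.mul ℝ ℂ) hf' hg'
  unfold IFT2
  simp only [ContinuousLinearMap.mul_apply'] at this
  rw [← this]
  refine integral_congr_ae (Eventually.of_forall fun p => ?_)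
  simp only [convolution, ContinuousLinearMap.mul_apply']
  change _ = e p * _
  rw [← integral_const_mul]
  refine integral_congr_ae (Eventually.of_forall fun q => ?_)
  simp only
  rw [headd p q]
  ring

/-- Parametric integrals of smooth functions with fixed compact support are smooth. -/
theorem contDiff_integral_param {P Q : Type*} [NormedAddCommGroup P] [NormedSpace ℝ P]
    [NormedAddCommGroup Q] [NormedSpace ℝ Q] [MeasurableSpace Q] [BorelSpace Q]
    {μ : Measure Q} [μ.IsAddLeftInvariant] [μ.IsNegInvariant] {f : Q → ℂ} {K : P → Q → ℂ}
    {k : Set Q} (hk : IsCompact k) (hK : ∀ p, ∀ q ∉ k, K p q = 0)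
    (hf : LocallyIntegrable f μ) (hKs : ContDiff ℝ ∞ fun x : P × Q => K x.1 x.2) :
    ContDiff ℝ ∞ fun p => ∫ q, f q * K p q ∂μ := by
  have := contDiffOn_convolution_right_with_param_comp (μ := μ) (n := ⊤)
    (ContinuousLinearMap.mul ℝ ℂ) (s := (Set.univ : Set P)) (v := fun _ => (0 : Q))
    contDiffOn_const (f := f) (g := fun p q => K p (-q)) (k := -k) isOpen_univ hk.neg
    (fun p q _ hq => hK p _ (by simpa using hq)) hf
    (by
      refine ContDiff.contDiffOn ?_
      exact hKs.comp (contDiff_fst.prodMk contDiff_snd.neg))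
  rw [contDiffOn_univ] at this
  simpa [convolution] using this

end Fourier

section Duhamel

/-- The dispersion relation of `W_α`. -/
def phase (α : ℝ) (p : ℝ × ℝ) : ℝ := p.1 ^ 3 + Real.sign p.1 * |p.1| ^ α * p.2 ^ 2

/-- The Fourier-side evolution `e^{-itω} f`. -/
def evol (α t : ℝ) (f : ℝ × ℝ → ℂ) (p : ℝ × ℝ) : ℂ :=
  Complex.exp (-Complex.I * (t : ℂ) * (phase α p : ℂ)) * f p

theorem Wgrp_eq {α t : ℝ} {g f : ℝ × ℝ → ℂ} (h : FT2 g = f) :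
    Wgrp α t g = IFT2 (evol α t f) := by
  subst h
  rfl

theorem evol_eq_zero {α t : ℝ} {f : ℝ × ℝ → ℂ} {p : ℝ × ℝ} (h : f p = 0) : evol α t f p = 0 := by
  simp [evol, h]

/-- Away from `ξ = 0` the dispersion relation agrees with a globally smooth function. -/
theorem exists_contDiff_phase (α : ℝ) {c : ℝ} (hc : 0 < c) :
    ∃ w : ℝ × ℝ → ℝ, ContDiff ℝ ∞ w ∧ ∀ p : ℝ × ℝ, c ≤ p.1 → w p = phase α p := by
  have hρ : ContDiff ℝ ∞ fun x : ℝ => Real.smoothTransition (2 * x / c - 1) * x ^ α := by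
    rw [contDiff_iff_contDiffAt]
    intro x
    rcases le_or_gt x 0 with hx | hx
    · refine (contDiffAt_const (c := (0 : ℝ))).congr_of_eventuallyEq ?_
      filter_upwards [Iio_mem_nhds (show x < c / 2 by linarith)] with y hy
      rw [Real.smoothTransition.zero_of_nonpos, zero_mul]
      have : 2 * y / c ≤ 1 := by
        rw [div_le_one hc]
        linarith [Set.mem_Iio.1 hy]
      linarith
    · refine ContDiffAt.mul ?_ (Real.contDiffAt_rpow_const_of_ne hx.ne')
      exact (Real.smoothTransition.contDiff.comp (by fun_prop)).contDiffAt
  refine ⟨fun p => p.1 ^ 3 + (Real.smoothTransition (2 * p.1 / c - 1) * p.1 ^ α) * p.2 ^ 2,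
    ?_, ?_⟩
  · exact (contDiff_fst.pow 3).add ((hρ.comp contDiff_fst).mul (contDiff_snd.pow 2))
  · intro p hp
    have hp0 : 0 < p.1 := hc.trans_le hp
    have : 1 ≤ 2 * p.1 / c - 1 := by
      have : 2 ≤ 2 * p.1 / c := by
        rw [le_div_iff₀ hc]
        linarith
      linarith
    simp only [phase]
    rw [Real.smoothTransition.one_of_one_le this, Real.sign_of_pos hp0, abs_of_pos hp0]

theorem contDiff_cexp_phase_mul {E : Type*} [NormedAddCommGroup E] [NormedSpace ℝ E] (α : ℝ)
    {c : ℝ} (hc : 0 < c) {τ : E → ℝ} {x : E → ℝ × ℝ} {g : E → ℂ} (hτ : ContDiff ℝ ∞ τ)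
    (hx : ContDiff ℝ ∞ x) (hg : ContDiff ℝ ∞ g) (h : ∀ y, g y ≠ 0 → c ≤ (x y).1) :
    ContDiff ℝ ∞ fun y =>
      Complex.exp (-Complex.I * (τ y : ℂ) * (phase α (x y) : ℂ)) * g y := by
  obtain ⟨w, hw, hwe⟩ := exists_contDiff_phase α hc
  have : (fun y => Complex.exp (-Complex.I * (τ y : ℂ) * (phase α (x y) : ℂ)) * g y) =
      fun y => Complex.exp (-Complex.I * (τ y : ℂ) * (w (x y) : ℂ)) * g y := by
    ext y
    by_cases hy : g y = 0
    · simp [hy]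
    · rw [hwe _ (h y hy)]
  rw [this]
  have h1 : ContDiff ℝ ∞ fun y => (τ y : ℂ) := Complex.ofRealCLM.contDiff.comp hτ
  have h2 : ContDiff ℝ ∞ fun y => (w (x y) : ℂ) := Complex.ofRealCLM.contDiff.comp (hw.comp hx)
  exact ((contDiff_const.mul h1).mul h2).cexp.mul hg

/-- The Fourier transform of `u ∂ₓu` where `u = W_α(s)φ` and `f = FT2 φ`. -/
def nonlin (α : ℝ) (f : ℝ × ℝ → ℂ) (s : ℝ) (p : ℝ × ℝ) : ℂ :=
  ∫ q, evol α s f q * (2 * Real.pi * Complex.I * (p - q).1 * evol α s f (p - q))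

/-- The Fourier transform of the Duhamel term with `f = FT2 φ`. -/
def duhamel (α t : ℝ) (f : ℝ × ℝ → ℂ) (p : ℝ × ℝ) : ℂ :=
  ∫ s in (0 : ℝ)..t, evol α (t - s) (nonlin α f s) p

variable {α c : ℝ} {f : ℝ × ℝ → ℂ}

theorem contDiff_evol (hc : 0 < c) (hf : ContDiff ℝ ∞ f) (hfc : ∀ p, f p ≠ 0 → c ≤ p.1) (s : ℝ) :
    ContDiff ℝ ∞ (evol α s f) :=
  contDiff_cexp_phase_mul α hc contDiff_const contDiff_id hf hfc

theorem hasCompactSupport_evol (hfs : HasCompactSupport f) (s : ℝ) :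
    HasCompactSupport (evol α s f) :=
  hfs.mul_left

theorem nonlin_ne_zero {s : ℝ} {p : ℝ × ℝ} (h : nonlin α f s p ≠ 0) :
    ∃ q, f q ≠ 0 ∧ f (p - q) ≠ 0 := by
  by_contra! hcon
  refine h ?_
  unfold nonlin
  rw [← integral_zero (ℝ × ℝ) ℂ]
  congr 1
  ext q
  by_cases hq : f q = 0
  · simp [evol_eq_zero hq]
  · simp [evol_eq_zero (hcon q hq)]

theorem contDiff_nonlin (hc : 0 < c) (hf : ContDiff ℝ ∞ f) (hfs : HasCompactSupport f)
    (hfc : ∀ p, f p ≠ 0 → c ≤ p.1) :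
    ContDiff ℝ ∞ fun x : ℝ × (ℝ × ℝ) => nonlin α f x.1 x.2 := by
  have := contDiff_integral_param (P := ℝ × (ℝ × ℝ)) (Q := ℝ × ℝ) (μ := volume) (f := fun _ => 1)
    (K := fun x q => evol α x.1 f q *
      (2 * Real.pi * Complex.I * (x.2 - q).1 * evol α x.1 f (x.2 - q)))
    (k := tsupport f) hfs
    (fun x q hq => by rw [evol_eq_zero (image_eq_zero_of_notMem_tsupport hq), zero_mul])
    (locallyIntegrable_const 1)
    (by
      refine ContDiff.mul ?_ (ContDiff.mul ?_ ?_)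
      · exact contDiff_cexp_phase_mul α hc (τ := fun y : (ℝ × (ℝ × ℝ)) × (ℝ × ℝ) => y.1.1)
          (x := fun y => y.2) (g := fun y => f y.2) (by fun_prop) (by fun_prop)
          (hf.comp contDiff_snd) (fun y hy => hfc _ hy)
      · exact contDiff_const.mul (Complex.ofRealCLM.contDiff.comp
          (contDiff_fst.comp (contDiff_fst.snd.sub contDiff_snd)))
      · exact contDiff_cexp_phase_mul α hc (τ := fun y : (ℝ × (ℝ × ℝ)) × (ℝ × ℝ) => y.1.1)
          (x := fun y => y.1.2 - y.2) (g := fun y => f (y.1.2 - y.2)) (by fun_prop) (by fun_prop)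
          (hf.comp (by fun_prop)) (fun y hy => hfc _ hy))
  simpa [nonlin] using this

/-- Everything needed about the Duhamel term on the Fourier side. -/
theorem FT2_duhamel (t : ℝ) (hc : 0 < c) (hf : ContDiff ℝ ∞ f) (hfs : HasCompactSupport f)
    (hfc : ∀ p, f p ≠ 0 → c ≤ p.1) :
    FT2 (fun z => ∫ s in (0 : ℝ)..t, Wgrp α (t - s) (fun w => Wgrp α s (IFT2 f) w *
      deriv (fun a => Wgrp α s (IFT2 f) (a, w.2)) w.1) z) = duhamel α t f ∧
    Continuous (duhamel α t f) ∧ HasCompactSupport (duhamel α t f) := by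
  have hk2 : IsCompact (tsupport f + tsupport f) := hfs.isCompact.add hfs.isCompact
  have hGk : ∀ s p, p ∉ tsupport f + tsupport f → nonlin α f s p = 0 := by
    intro s p hp
    by_contra h
    obtain ⟨q, hq1, hq2⟩ := nonlin_ne_zero h
    exact hp ⟨q, subset_tsupport _ hq1, p - q, subset_tsupport _ hq2, by simp⟩
  have hGc : ∀ s p, nonlin α f s p ≠ 0 → c ≤ p.1 := by
    intro s p h
    obtain ⟨q, hq1, hq2⟩ := nonlin_ne_zero h
    have h1 := hfc _ hq1
    have h2 := hfc _ hq2
    simp only [Prod.fst_sub] at h2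
    linarith
  have hGs := contDiff_nonlin (α := α) hc hf hfs hfc
  have hprod : ∀ s w, Wgrp α s (IFT2 f) w * deriv (fun a => Wgrp α s (IFT2 f) (a, w.2)) w.1 =
      IFT2 (nonlin α f s) w := by
    intro s w
    have hFc := (contDiff_evol (α := α) hc hf hfc s).continuous
    have hFs := hasCompactSupport_evol (α := α) hfs s
    rw [Wgrp_eq (FT2_IFT2 hf hfs), deriv_IFT2 hFc hFs w]
    exact IFT2_mul (hFc.integrable_of_hasCompactSupport hFs)
      ((by fun_prop : Continuous _).integrable_of_hasCompactSupport hFs.mul_left) w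
  let θ : ContDiffBump (0 : ℝ) := ⟨|t| + 1, |t| + 2, by positivity, by linarith⟩
  have hθ : ∀ s ∈ Set.uIcc 0 t, θ s = 1 := by
    intro s hs
    refine θ.one_of_mem_closedBall ?_
    rw [mem_closedBall_zero_iff, Real.norm_eq_abs]
    have : |s| ≤ |t| := by
      have := Set.abs_sub_left_of_mem_uIcc hs
      simpa using this
    change |s| ≤ |t| + 1
    linarith
  let L : ℝ → ℝ × ℝ → ℂ := fun s p => (θ s : ℂ) * evol α (t - s) (nonlin α f s) p
  have hLs : ContDiff ℝ ∞ fun x : ℝ × (ℝ × ℝ) => L x.1 x.2 := by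
    refine ContDiff.mul ?_ ?_
    · exact Complex.ofRealCLM.contDiff.comp (θ.contDiff.comp contDiff_fst)
    · exact contDiff_cexp_phase_mul α hc (τ := fun y : ℝ × (ℝ × ℝ) => t - y.1)
          (x := fun y => y.2) (g := fun y => nonlin α f y.1 y.2) (by fun_prop) (by fun_prop)
          hGs (fun y hy => hGc _ _ hy)
  have hLe : ∀ p, duhamel α t f p = ∫ s in (0 : ℝ)..t, L s p := by
    intro p
    refine intervalIntegral.integral_congr fun s hs => ?_
    simp only [L, hθ s hs, Complex.ofReal_one, one_mul]
  have hLk : ∀ s p, p ∉ tsupport f + tsupport f → L s p = 0 := by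
    intro s p hp
    simp only [L]
    rw [evol_eq_zero (hGk s p hp), mul_zero]
  have hLθ : ∀ p, ∀ s ∉ Metric.closedBall (0 : ℝ) (|t| + 2), L s p = 0 := by
    intro p s hs
    have : θ s = 0 := θ.zero_of_le_dist (not_le.1 hs).le
    simp [L, this]
  have hHs : HasCompactSupport (duhamel α t f) := by
    refine HasCompactSupport.intro hk2 fun p hp => ?_
    rw [hLe]
    simp [hLk _ p hp]
  have hHd : ContDiff ℝ ∞ (duhamel α t f) := by
    have : ∀ a b : ℝ, ContDiff ℝ ∞ fun p => ∫ s in Set.Ioc a b, L s p := by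
      intro a b
      have := contDiff_integral_param (P := ℝ × ℝ) (Q := ℝ) (μ := volume)
        (f := (Set.Ioc a b).indicator fun _ => 1) (K := fun p s => L s p)
        (isCompact_closedBall (0 : ℝ) (|t| + 2)) hLθ
        ((locallyIntegrable_const 1).indicator measurableSet_Ioc)
        (hLs.comp (contDiff_snd.prodMk contDiff_fst))
      convert this using 2 with p
      rw [← integral_indicator measurableSet_Ioc]
      congr 1
      ext s
      by_cases hs : s ∈ Set.Ioc a b <;> simp [hs]
    have h2 := (this 0 t).sub (this t 0)
    convert h2 using 1
    ext p
    rw [hLe]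
    rfl
  refine ⟨?_, hHd.continuous, hHs⟩
  rw [← FT2_IFT2 hHd hHs]
  congr 1
  ext z
  have h1 : ∀ s ∈ Set.uIcc 0 t, Wgrp α (t - s) (fun w => Wgrp α s (IFT2 f) w *
      deriv (fun a => Wgrp α s (IFT2 f) (a, w.2)) w.1) z = IFT2 (L s) z := by
    intro s hs
    have h2 : (fun w => Wgrp α s (IFT2 f) w * deriv (fun a => Wgrp α s (IFT2 f) (a, w.2)) w.1) =
      IFT2 (nonlin α f s) := funext (hprod s)
    have h3 : ContDiff ℝ ∞ (nonlin α f s) :=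
      hGs.comp (f := fun p : ℝ × ℝ => (s, p)) (contDiff_const.prodMk contDiff_id)
    rw [h2, Wgrp_eq (FT2_IFT2 h3 (HasCompactSupport.intro hk2 (hGk s)))]
    congr 1
    ext p
    simp only [L, hθ s hs, Complex.ofReal_one, one_mul]
  rw [intervalIntegral.integral_congr h1]
  unfold IFT2
  simp only [hLe, ← intervalIntegral.integral_const_mul]
  refine intervalIntegral_integral_swap ?_
  have hint : Integrable (Function.uncurry fun (s : ℝ) (p : ℝ × ℝ) =>
      Complex.exp (((2 * Real.pi * (z.1 * p.1 + z.2 * p.2) : ℝ) : ℂ) * Complex.I) * L s p)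
      (volume.prod volume) := by
    have hLc := hLs.continuous
    refine Continuous.integrable_of_hasCompactSupport ?_ ?_
    · exact ((continuous_character z).comp continuous_snd).mul hLc
    · refine HasCompactSupport.intro ((isCompact_closedBall (0 : ℝ) (|t| + 2)).prod hk2) ?_
      rintro ⟨s, p⟩ hsp
      by_cases hs : s ∈ Metric.closedBall (0 : ℝ) (|t| + 2)
      · have hp : p ∉ tsupport f + tsupport f := fun hp => hsp ⟨hs, hp⟩
        simp [Function.uncurry, hLk s p hp]
      · simp [Function.uncurry, hLθ p s hs]
  exact hint.mono_measure (Measure.prod_mono Measure.restrict_le_self le_rfl)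

end Duhamel

section Estimates

theorem rpow_one_add_bounds {α z : ℝ} (h1 : -1 ≤ α) (h2 : α ≤ 0) (hz : 0 ≤ z) :
    1 + α * z ≤ (1 + z) ^ α ∧ (1 + z) ^ α ≤ 1 + α * z + z ^ 2 := by
  have hz1 : 0 < 1 + z := by linarith
  constructor
  · have h := rpow_one_add_le_one_add_mul_self (s := z) (by linarith) (p := -α) (by linarith)
      (by linarith)
    have hpos : 0 < (1 + z) ^ (-α) := Real.rpow_pos_of_pos hz1 _
    have hmul : (1 + z) ^ α * (1 + z) ^ (-α) = 1 := by
      rw [← Real.rpow_add hz1, add_neg_cancel, Real.rpow_zero]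
    have hp : 0 < (1 + z) ^ α := Real.rpow_pos_of_pos hz1 _
    have h3 : 1 ≤ (1 + z) ^ α * (1 - α * z) := by
      have := mul_le_mul_of_nonneg_left h hp.le
      rw [hmul] at this
      linarith
    have h4 : 0 < 1 - α * z := by nlinarith
    by_contra! hcon
    have : (1 + z) ^ α * (1 - α * z) < (1 + α * z) * (1 - α * z) :=
      mul_lt_mul_of_pos_right hcon h4
    nlinarith [sq_nonneg (α * z)]
  · have h := rpow_one_add_le_one_add_mul_self (s := z) (by linarith) (p := α + 1) (by linarith)
      (by linarith)
    rw [Real.rpow_add hz1, Real.rpow_one] at h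
    by_contra! hcon
    have := mul_lt_mul_of_pos_right hcon hz1
    nlinarith [mul_nonneg hz hz, mul_nonneg (mul_nonneg hz hz) hz,
      mul_nonneg (mul_nonneg hz hz) (by linarith : 0 ≤ 1 + α)]

theorem phase_of_pos {α : ℝ} {p : ℝ × ℝ} (h : 0 < p.1) :
    phase α p = p.1 ^ 3 + p.1 ^ α * p.2 ^ 2 := by
  rw [phase, Real.sign_of_pos h, abs_of_pos h, one_mul]

/-- The scales of the counterexample: a low frequency box of size `γ × δ` interacting with a box
at `(N, η₀)`, where `η₀` is chosen so that the group velocities in `x` agree. -/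
structure Scales (α N γ δ η₀ : ℝ) : Prop where
  neg_one_le : -1 ≤ α
  neg : α < 0
  le_N : 16 ≤ N
  γ_pos : 0 < γ
  δ_pos : 0 < δ
  η_pos : 0 < η₀
  N_mul_sq : N * γ ^ 2 = 1
  velocity : -α * N ^ α * η₀ ^ 2 = 3 * N ^ 3
  δ_eq : N ^ α * η₀ * δ = 1

namespace Scales

variable {α N γ δ η₀ : ℝ}

theorem exists_scales {α N : ℝ} (h1 : -1 ≤ α) (h2 : α < 0) (hN : 16 ≤ N) :
    ∃ γ δ η₀, Scales α N γ δ η₀ := by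
  have hN0 : 0 < N := by linarith
  have hA : 0 < N ^ α := Real.rpow_pos_of_pos hN0 α
  have hα : 0 < -α := by linarith
  have hη : 0 < 3 * N ^ 3 / (-α * N ^ α) := by positivity
  have hη' := Real.sqrt_pos.2 hη
  refine ⟨(Real.sqrt N)⁻¹, 1 / (N ^ α * Real.sqrt (3 * N ^ 3 / (-α * N ^ α))),
    Real.sqrt (3 * N ^ 3 / (-α * N ^ α)), h1, h2, hN, by positivity, by positivity, hη', ?_, ?_, ?_⟩
  · rw [inv_pow, Real.sq_sqrt hN0.le, mul_inv_cancel₀ hN0.ne']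
  · rw [Real.sq_sqrt hη.le]
    exact mul_div_cancel₀ _ (mul_pos hα hA).ne'
  · exact mul_one_div_cancel (mul_pos hA hη').ne'

variable (S : Scales α N γ δ η₀)
include S

theorem N_pos : 0 < N := by linarith [S.le_N]

theorem γ_le : γ ≤ 1 / 4 := by
  have := S.N_mul_sq
  have h := S.le_N
  have hγ := S.γ_pos
  by_contra! hc
  nlinarith

theorem A_pos : 0 < N ^ α := Real.rpow_pos_of_pos S.N_pos α

theorem A_le : N ^ α ≤ 1 :=
  Real.rpow_le_one_of_one_le_of_nonpos (by linarith [S.le_N]) S.neg.le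

theorem one_le_N_mul_A : 1 ≤ N * N ^ α := by
  have h := Real.rpow_le_rpow_of_exponent_le (by linarith [S.le_N] : 1 ≤ N) S.neg_one_le
  rw [Real.rpow_neg_one] at h
  have := mul_le_mul_of_nonneg_left h S.N_pos.le
  rwa [mul_inv_cancel₀ S.N_pos.ne'] at this

theorem N_le_η : N ≤ η₀ := by
  have h := S.velocity
  have hA := S.A_le
  have hA0 := S.A_pos
  have hN := S.le_N
  have h1 : -α * N ^ α ≤ 1 := by nlinarith [S.neg, S.neg_one_le]
  have h2 : 3 * N ^ 3 ≤ η₀ ^ 2 := by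
    rw [← h]
    nlinarith [sq_nonneg η₀]
  refine le_of_sq_le_sq ?_ S.η_pos.le
  nlinarith [sq_nonneg N]

theorem δ_sq : 3 * N ^ α * N ^ 3 * δ ^ 2 = -α := by
  have h := S.velocity
  have h2 := S.δ_eq
  calc 3 * N ^ α * N ^ 3 * δ ^ 2 = N ^ α * δ ^ 2 * (3 * N ^ 3) := by ring
    _ = -α * (N ^ α * η₀ * δ) ^ 2 := by rw [← h]; ring
    _ = -α := by rw [h2]; ring

theorem N_sq_mul_δ_sq : 3 * (N ^ 2 * δ ^ 2) ≤ 1 := by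
  have h := S.δ_sq
  have h1 := S.one_le_N_mul_A
  have h2 : 0 ≤ N ^ 2 * δ ^ 2 := by positivity
  have h3 := S.neg_one_le
  nlinarith [mul_le_mul_of_nonneg_right h1 h2]

theorem δ_le : δ ≤ 1 / 16 := by
  have h := S.N_sq_mul_δ_sq
  have hN := S.le_N
  have hδ := S.δ_pos
  by_contra! hc
  have : 1 < N * δ := by nlinarith
  nlinarith

/-- The gain in the bilinear estimate. -/
theorem gain_sq : 3 * (N ^ 2 * (γ * δ)) ^ 2 = -α * N ^ (-α) := by
  have h := S.δ_sq
  have h1 := S.N_mul_sq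
  have hA : N ^ (-α) * N ^ α = 1 := by
    rw [← Real.rpow_add S.N_pos, neg_add_cancel, Real.rpow_zero]
  calc 3 * (N ^ 2 * (γ * δ)) ^ 2 = (N * γ ^ 2) * (3 * N ^ 3 * δ ^ 2) * 1 := by ring
    _ = (N * γ ^ 2) * (3 * N ^ 3 * δ ^ 2) * (N ^ (-α) * N ^ α) := by rw [hA]
    _ = (N * γ ^ 2) * (3 * N ^ α * N ^ 3 * δ ^ 2) * N ^ (-α) := by ring
    _ = _ := by rw [h, h1, one_mul]

/-- The low frequency phase is bounded. -/
theorem phase_low {q : ℝ × ℝ} (h1 : γ ≤ q.1) (h2 : q.1 ≤ 4 * γ) (h3 : 0 ≤ q.2)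
    (h4 : q.2 ≤ 4 * δ) : 0 ≤ phase α q ∧ phase α q ≤ 2 := by
  obtain ⟨ξ, η⟩ := q
  simp only at h1 h2 h3 h4
  have hγ := S.γ_pos
  have hγ4 := S.γ_le
  have hξ : 0 < ξ := hγ.trans_le h1
  rw [phase_of_pos hξ]
  simp only
  have hp : 0 < ξ ^ α := Real.rpow_pos_of_pos hξ α
  refine ⟨by positivity, ?_⟩
  have e1 : ξ ^ 3 ≤ 1 := pow_le_one₀ hξ.le (by linarith)
  have e2 : ξ ^ α ≤ N * γ := by
    calc ξ ^ α ≤ γ ^ α := Real.rpow_le_rpow_of_nonpos hγ h1 S.neg.le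
      _ ≤ γ ^ (-1 : ℝ) := Real.rpow_le_rpow_of_exponent_ge hγ (by linarith) S.neg_one_le
      _ = N * γ := by
        rw [Real.rpow_neg_one]
        refine inv_eq_of_mul_eq_one_right ?_
        linarith [S.N_mul_sq, (by ring : γ * (N * γ) = N * γ ^ 2)]
  have e3 : η ^ 2 ≤ 16 * δ ^ 2 := by nlinarith
  have e4 : ξ ^ α * η ^ 2 ≤ (N * γ) * (16 * δ ^ 2) := by
    refine mul_le_mul e2 e3 (by positivity) (by have := S.N_pos; positivity)
  have e5 := S.N_sq_mul_δ_sq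
  have e6 := S.le_N
  have e7 : (N * γ) * (16 * δ ^ 2) ≤ N ^ 2 * δ ^ 2 := by
    have : 0 ≤ N * δ ^ 2 := by have := S.N_pos; positivity
    nlinarith
  linarith

/-- The resonance function is bounded on the interacting boxes. -/
theorem resonance {q r : ℝ × ℝ} (h1 : γ ≤ q.1) (h2 : q.1 ≤ 4 * γ) (h3 : 0 ≤ q.2)
    (h4 : q.2 ≤ 4 * δ) (k1 : N ≤ r.1) (k2 : r.1 ≤ N + 4 * γ) (k3 : η₀ ≤ r.2)
    (k4 : r.2 ≤ η₀ + 4 * δ) :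
    |phase α (q + r) - phase α q - phase α r| ≤ 600 + 200 / (-α) := by
  obtain ⟨hq0, hq2⟩ := S.phase_low h1 h2 h3 h4
  obtain ⟨ξ, η⟩ := q
  obtain ⟨M, B⟩ := r
  simp only at h1 h2 h3 h4 k1 k2 k3 k4
  have hγ := S.γ_pos
  have hγ4 := S.γ_le
  have hδ := S.δ_pos
  have hδ1 := S.δ_le
  have hη0 := S.η_pos
  have hN := S.N_pos
  have hN16 := S.le_N
  have hA := S.A_pos
  have hNη := S.N_le_η
  have hNγ := S.N_mul_sq
  have hξ : 0 < ξ := hγ.trans_le h1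
  have hM : 0 < M := hN.trans_le k1
  have hMN : M ≤ 2 * N := by linarith
  have hB : 0 < B := hη0.trans_le k3
  have hB2 : B ≤ 2 * η₀ := by linarith
  have hα : 0 < -α := by linarith [S.neg]
  have hξM : 0 < M + ξ := by linarith
  have hξ2 : N * ξ ^ 2 ≤ 16 := by
    calc N * ξ ^ 2 ≤ N * (4 * γ) ^ 2 := by gcongr
      _ = 16 * (N * γ ^ 2) := by ring
      _ ≤ 16 := by rw [hNγ]; norm_num
  rw [phase_of_pos (p := ((ξ, η) : ℝ × ℝ) + (M, B)) (by simp only [Prod.fst_add]; linarith),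
    phase_of_pos (p := ((M, B) : ℝ × ℝ)) hM]
  simp only [Prod.fst_add, Prod.snd_add]
  set z := ξ / M with hz
  set y := (M - N) / N with hy
  have hz0 : 0 ≤ z := by positivity
  have hy0 : 0 ≤ y := div_nonneg (by linarith) hN.le
  have hzM : z * M = ξ := div_mul_cancel₀ _ hM.ne'
  have hyN : y * N = M - N := div_mul_cancel₀ _ hN.ne'
  have hMy : M = N * (1 + y) := by linarith
  have hsum : ξ + M = M * (1 + z) := by linarith
  obtain ⟨z1, z2⟩ := rpow_one_add_bounds S.neg_one_le S.neg.le hz0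
  obtain ⟨y1, -⟩ := rpow_one_add_bounds S.neg_one_le S.neg.le hy0
  have y3 : (1 + y) ^ α ≤ 1 := Real.rpow_le_one_of_one_le_of_nonpos (by linarith) S.neg.le
  have hMα : M ^ α = N ^ α * (1 + y) ^ α := by
    rw [← Real.mul_rpow hN.le (by linarith), ← hMy]
  have hsα : (ξ + M) ^ α = M ^ α * (1 + z) ^ α := by
    rw [← Real.mul_rpow hM.le (by linarith), ← hsum]
  have hMpos : 0 < M ^ α := Real.rpow_pos_of_pos hM α
  have hspos : 0 < (ξ + M) ^ α := Real.rpow_pos_of_pos (by linarith) α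
  have hMA : M ^ α ≤ N ^ α := Real.rpow_le_rpow_of_nonpos hN k1 S.neg.le
  have hsA : (ξ + M) ^ α ≤ N ^ α := Real.rpow_le_rpow_of_nonpos hN (by linarith) S.neg.le
  -- cubic part
  have c0 : 0 ≤ 3 * M * ξ ^ 2 + ξ ^ 3 := by positivity
  have c1 : 3 * M * ξ ^ 2 + ξ ^ 3 ≤ 97 := by
    have e1 : ξ ^ 3 ≤ 1 := pow_le_one₀ hξ.le (by linarith)
    linarith [mul_le_mul_of_nonneg_right hMN (sq_nonneg ξ)]
  -- increment in the second variable
  have d0 : 0 ≤ (ξ + M) ^ α * (2 * B * η + η ^ 2) := by positivity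
  have d1 : (ξ + M) ^ α * (2 * B * η + η ^ 2) ≤ 32 := by
    have e1 : 2 * B * η + η ^ 2 ≤ 32 * (η₀ * δ) := by
      have : B * η ≤ (2 * η₀) * (4 * δ) := mul_le_mul hB2 h4 h3 (by positivity)
      have : η * η ≤ (4 * δ) * (4 * δ) := mul_le_mul h4 h4 h3 (by positivity)
      have h6 : δ * δ ≤ η₀ * δ := by gcongr; linarith
      linarith [sq η]
    calc _ ≤ N ^ α * (32 * (η₀ * δ)) := mul_le_mul hsA e1 (by positivity) hA.le
      _ = 32 * (N ^ α * η₀ * δ) := by ring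
      _ = 32 := by rw [S.δ_eq]; ring
  -- Taylor remainder
  set R := M ^ α * ((1 + z) ^ α - 1 - α * z) * B ^ 2 with hR
  have r0 : 0 ≤ R := by
    have : 0 ≤ (1 + z) ^ α - 1 - α * z := by linarith
    positivity
  have r1 : R ≤ 200 / (-α) := by
    have e1 : z ^ 2 ≤ 16 / N ^ 3 := by
      rw [le_div_iff₀ (by positivity)]
      calc z ^ 2 * N ^ 3 = (z * N) ^ 2 * N := by ring
        _ ≤ (z * M) ^ 2 * N := by gcongr
        _ = N * ξ ^ 2 := by rw [hzM]; ring
        _ ≤ 16 := hξ2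
    have e2 : B ^ 2 ≤ 4 * η₀ ^ 2 := by linarith [pow_le_pow_left₀ hB.le hB2 2, mul_pow 2 η₀ 2]
    have e3 : R ≤ N ^ α * (16 / N ^ 3) * (4 * η₀ ^ 2) := by
      rw [hR]
      refine mul_le_mul (mul_le_mul hMA (by linarith) (by linarith) hA.le) e2 (by positivity)
        (by positivity)
    have e4 : N ^ α * (16 / N ^ 3) * (4 * η₀ ^ 2) = 192 / (-α) := by
      have := S.velocity
      rw [eq_div_iff hα.ne']
      field_simp
      linarith
    have e5 : 192 / (-α) ≤ 200 / (-α) := by gcongr; norm_num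
    linarith
  -- group velocity mismatch
  set μ := (1 + y) ^ α with hμ
  have hμ0 : 0 < μ := Real.rpow_pos_of_pos (by linarith) α
  set V := z * (3 * M ^ 3 - μ * (3 * N ^ 3)) with hV
  have v0 : 0 ≤ V := by
    have : N ^ 3 ≤ M ^ 3 := by gcongr
    have : μ * (3 * N ^ 3) ≤ 1 * (3 * N ^ 3) := by gcongr
    refine mul_nonneg hz0 (by linarith)
  have v1 : V ≤ 400 := by
    have ey : y * N ≤ 4 * γ := by linarith
    have ey1 : y ≤ 1 := (div_le_one hN).2 (by linarith)
    have eμ : 1 - y ≤ μ := by linarith [mul_le_mul_of_nonneg_right S.neg_one_le hy0]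
    have e1 : 3 * M ^ 3 - μ * (3 * N ^ 3) ≤ 24 * y * N ^ 3 := by
      have : (1 - y) * (3 * N ^ 3) ≤ μ * (3 * N ^ 3) := by gcongr
      have hy8 : (1 + y) ^ 3 - (1 - y) ≤ 8 * y := by
        have : y ^ 2 ≤ y := by rw [sq]; exact mul_le_of_le_one_left hy0 ey1
        have : y ^ 3 ≤ y ^ 2 := pow_le_pow_of_le_one hy0 ey1 (by norm_num)
        linarith [(by ring : (1 + y) ^ 3 = 1 + 3 * y + 3 * y ^ 2 + y ^ 3)]
      have := mul_le_mul_of_nonneg_right hy8 (by positivity : 0 ≤ 3 * N ^ 3)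
      rw [hMy]
      linarith [(by ring : 3 * (N * (1 + y)) ^ 3 = (1 + y) ^ 3 * (3 * N ^ 3))]
    have ez : z * N ≤ 4 * γ := by
      have : z * N ≤ z * M := by gcongr
      linarith
    calc V ≤ z * (24 * y * N ^ 3) := mul_le_mul_of_nonneg_left e1 hz0
      _ = 24 * N * ((z * N) * (y * N)) := by ring
      _ ≤ 24 * N * ((4 * γ) * (4 * γ)) := by gcongr
      _ = 384 * (N * γ ^ 2) := by ring
      _ ≤ 400 := by rw [hNγ]; norm_num
  -- spread of the high box in the second variable
  set Y := z * (μ * (-α * N ^ α * (B ^ 2 - η₀ ^ 2))) with hY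
  have hBη : 0 ≤ B ^ 2 - η₀ ^ 2 := by linarith [pow_le_pow_left₀ hη0.le k3 2]
  have w0 : 0 ≤ Y := by positivity
  have w1 : Y ≤ 24 := by
    have e1 : B ^ 2 - η₀ ^ 2 ≤ 24 * (η₀ * δ) := by
      have h5 := pow_le_pow_left₀ hB.le k4 2
      have h6 : δ * δ ≤ η₀ * δ := by gcongr; linarith
      linarith [(by ring : (η₀ + 4 * δ) ^ 2 = η₀ ^ 2 + 8 * (η₀ * δ) + 16 * (δ * δ))]
    have e2 : -α * N ^ α * (B ^ 2 - η₀ ^ 2) ≤ 24 := by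
      calc _ ≤ 1 * N ^ α * (24 * (η₀ * δ)) := by
            have : -α ≤ 1 := by linarith [S.neg_one_le]
            gcongr
        _ = 24 * (N ^ α * η₀ * δ) := by ring
        _ = 24 := by rw [S.δ_eq]; ring
    have e3 : z ≤ 1 := by
      rw [hz, div_le_one hM]
      linarith
    have e0 : 0 ≤ -α * N ^ α * (B ^ 2 - η₀ ^ 2) := by positivity
    calc Y ≤ 1 * (1 * 24) := by rw [hY]; gcongr
      _ = 24 := by norm_num
  have key : (ξ + M) ^ 3 + (ξ + M) ^ α * (η + B) ^ 2 - phase α (ξ, η) - (M ^ 3 + M ^ α * B ^ 2) =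
      (3 * M * ξ ^ 2 + ξ ^ 3) + (ξ + M) ^ α * (2 * B * η + η ^ 2) + R + V - Y
        - phase α (ξ, η) := by
    have hvel := S.velocity
    have t1 : V - Y = 3 * M ^ 2 * ξ + α * z * M ^ α * B ^ 2 := by
      rw [hV, hY, ← hvel, hMα, ← hzM]
      ring
    have t2 : (ξ + M) ^ α * B ^ 2 - M ^ α * B ^ 2 = R + α * z * M ^ α * B ^ 2 := by
      rw [hR, hsα]
      ring
    linear_combination t2 - t1
  rw [key, abs_le]
  have : 0 < 200 / (-α) := by positivity
  constructor <;> linarith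

end Scales

end Estimates

section LowerBound

theorem volume_real_Icc_prod {a b c d : ℝ} (h1 : a ≤ b) (h2 : c ≤ d) :
    volume.real (Set.Icc a b ×ˢ Set.Icc c d) = (b - a) * (d - c) := by
  rw [Measure.volume_eq_prod, measureReal_prod_prod, Real.volume_real_Icc_of_le h1,
    Real.volume_real_Icc_of_le h2]

theorem volume_Icc_prod_ne_top (a b c d : ℝ) :
    volume (Set.Icc a b ×ˢ Set.Icc c d) ≠ ⊤ :=
  (isCompact_Icc.prod isCompact_Icc).measure_ne_top

/-- If the phases do not oscillate, the Duhamel term of a nonnegative amplitude is bounded below. -/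
theorem le_norm_duhamel {α c t m : ℝ} {g : ℝ × ℝ → ℝ} {p : ℝ × ℝ} {B : Set (ℝ × ℝ)} (ht : 0 ≤ t)
    (hc : 0 < c) (hg : ContDiff ℝ ∞ g) (hgs : HasCompactSupport g)
    (hgc : ∀ q, g q ≠ 0 → c ≤ q.1) (hg0 : ∀ q, 0 ≤ g q) (hB : MeasurableSet B)
    (hBf : volume B ≠ ⊤)
    (hres : ∀ q, g q ≠ 0 → g (p - q) ≠ 0 →
      t * |phase α p - phase α q - phase α (p - q)| ≤ 1)
    (hgB : ∀ q ∈ B, m ≤ g q * ((p - q).1 * g (p - q))) :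
    Real.pi * m * volume.real B * t ≤ ‖duhamel α t (fun q => (g q : ℂ)) p‖ := by
  set f : ℝ × ℝ → ℂ := fun q => (g q : ℂ) with hfdef
  have hf : ContDiff ℝ ∞ f := Complex.ofRealCLM.contDiff.comp hg
  have hfs : HasCompactSupport f := hgs.comp_left Complex.ofReal_zero
  have hfc : ∀ q, f q ≠ 0 → c ≤ q.1 := fun q hq => hgc q (by simpa [hfdef] using hq)
  set χ : ℝ × ℝ → ℝ := fun q => phase α p - phase α q - phase α (p - q) with hχ
  set ρ : ℝ × ℝ → ℝ := fun q => g q * ((p - q).1 * g (p - q)) with hρ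
  have hρ0 : ∀ q, 0 ≤ ρ q := by
    intro q
    by_cases h : g (p - q) = 0
    · simp [hρ, h]
    · exact mul_nonneg (hg0 q) (mul_nonneg (hc.le.trans (hgc _ h)) (hg0 _))
  set κ : ℂ := Complex.exp (Complex.I * t * phase α p) * (-Complex.I) with hκ
  have hκn : ‖κ‖ = 1 := by
    rw [hκ, norm_mul, norm_neg, Complex.norm_I, mul_one,
      show Complex.I * t * phase α p = ((t * phase α p : ℝ) : ℂ) * Complex.I by push_cast; ring,
      Complex.norm_exp_ofReal_mul_I]
  have hint : ∀ s, Integrable fun q =>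
      evol α s f q * (2 * Real.pi * Complex.I * (p - q).1 * evol α s f (p - q)) := by
    intro s
    have h1 := (contDiff_evol (α := α) hc hf hfc s).continuous
    refine Continuous.integrable_of_hasCompactSupport (by fun_prop) ?_
    exact (hasCompactSupport_evol hfs s).mul_right
  have hpt : ∀ s q, (κ * Complex.exp (-Complex.I * ((t - s : ℝ) : ℂ) * (phase α p : ℂ)) *
      (evol α s f q * (2 * Real.pi * Complex.I * (p - q).1 * evol α s f (p - q)))).re =
      2 * Real.pi * ρ q * Real.cos (s * χ q) := by
    intro s q
    have e1 : Complex.exp (Complex.I * t * phase α p) *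
        Complex.exp (-Complex.I * ((t - s : ℝ) : ℂ) * (phase α p : ℂ)) *
        Complex.exp (-Complex.I * (s : ℂ) * (phase α q : ℂ)) *
        Complex.exp (-Complex.I * (s : ℂ) * (phase α (p - q) : ℂ)) =
        Complex.exp (((s * χ q : ℝ) : ℂ) * Complex.I) := by
      simp only [← Complex.exp_add]
      congr 1
      rw [hχ]
      push_cast
      ring
    have e2 : κ * Complex.exp (-Complex.I * ((t - s : ℝ) : ℂ) * (phase α p : ℂ)) *
        (evol α s f q * (2 * Real.pi * Complex.I * (p - q).1 * evol α s f (p - q))) =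
        ((2 * Real.pi * ρ q : ℝ) : ℂ) * Complex.exp (((s * χ q : ℝ) : ℂ) * Complex.I) := by
      rw [← e1, hκ, hρ]
      simp only [evol, hfdef]
      push_cast
      linear_combination (-2 * Real.pi * ((p - q).1 : ℝ) * g q * g (p - q) *
        Complex.exp (Complex.I * t * phase α p) *
        Complex.exp (-Complex.I * ((t : ℂ) - s) * (phase α p : ℂ)) *
        Complex.exp (-Complex.I * (s : ℂ) * (phase α q : ℂ)) *
        Complex.exp (-Complex.I * (s : ℂ) * (phase α (p - q) : ℂ))) * Complex.I_sq
    rw [e2, Complex.re_ofReal_mul, Complex.exp_ofReal_mul_I_re]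
  have hre : ∀ s ∈ Set.Icc 0 t, Real.pi * m * volume.real B ≤
      (κ * evol α (t - s) (nonlin α f s) p).re := by
    intro s hs
    have e1 : κ * evol α (t - s) (nonlin α f s) p =
        ∫ q, κ * Complex.exp (-Complex.I * ((t - s : ℝ) : ℂ) * (phase α p : ℂ)) *
          (evol α s f q * (2 * Real.pi * Complex.I * (p - q).1 * evol α s f (p - q))) := by
      rw [integral_const_mul, evol, nonlin]
      ring
    have hi := (hint s).const_mul
      (κ * Complex.exp (-Complex.I * ((t - s : ℝ) : ℂ) * (phase α p : ℂ)))
    have e2 := Complex.reCLM.integral_comp_comm hi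
    simp only [Complex.reCLM_apply] at e2
    rw [e1, ← e2]
    have e3 : Real.pi * m * volume.real B = ∫ q, B.indicator (fun _ => Real.pi * m) q := by
      rw [integral_indicator hB, setIntegral_const, smul_eq_mul, mul_comm]
    rw [e3]
    refine integral_mono ((integrable_indicator_iff hB).2 (integrableOn_const hBf)) hi.re ?_
    intro q
    simp only
    refine le_of_le_of_eq ?_ (hpt s q).symm
    have hcos : Real.pi * ρ q ≤ 2 * Real.pi * ρ q * Real.cos (s * χ q) := by
      by_cases h0 : ρ q = 0
      · simp [h0]
      · have h1 : g q ≠ 0 := fun h => h0 (by simp [hρ, h])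
        have h2 : g (p - q) ≠ 0 := fun h => h0 (by simp [hρ, h])
        have h3 := hres q h1 h2
        have h4 : |s * χ q| ≤ 1 := by
          rw [abs_mul, abs_of_nonneg hs.1]
          exact (mul_le_mul_of_nonneg_right hs.2 (abs_nonneg _)).trans h3
        have h5 : (s * χ q) ^ 2 ≤ 1 := (sq_le_one_iff_abs_le_one _).2 h4
        have h6 := Real.one_sub_sq_div_two_le_cos (x := s * χ q)
        have h7 : 0 ≤ Real.pi * ρ q := mul_nonneg Real.pi_pos.le (hρ0 q)
        nlinarith
    refine le_trans ?_ hcos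
    by_cases hq : q ∈ B
    · rw [Set.indicator_of_mem hq]
      exact mul_le_mul_of_nonneg_left (hgB q hq) Real.pi_pos.le
    · rw [Set.indicator_of_notMem hq]
      exact mul_nonneg Real.pi_pos.le (hρ0 q)
  have hcont : Continuous fun s => κ * evol α (t - s) (nonlin α f s) p := by
    have hG : Continuous fun s : ℝ => nonlin α f s p :=
      (contDiff_nonlin (α := α) hc hf hfs hfc).continuous.comp
        (f := fun s : ℝ => (s, p)) (by fun_prop)
    unfold evol
    fun_prop
  have hH : (κ * duhamel α t f p).re =
      ∫ s in (0 : ℝ)..t, (κ * evol α (t - s) (nonlin α f s) p).re := by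
    rw [duhamel, ← intervalIntegral.integral_const_mul]
    have := Complex.reCLM.intervalIntegral_comp_comm (hcont.intervalIntegrable (μ := volume) 0 t)
    simpa only [Complex.reCLM_apply] using this.symm
  calc Real.pi * m * volume.real B * t
      = ∫ _ in (0 : ℝ)..t, Real.pi * m * volume.real B := by
        rw [intervalIntegral.integral_const, sub_zero, smul_eq_mul, mul_comm]
    _ ≤ ∫ s in (0 : ℝ)..t, (κ * evol α (t - s) (nonlin α f s) p).re :=
        intervalIntegral.integral_mono_on ht intervalIntegrable_const
          ((Complex.continuous_re.comp hcont).intervalIntegrable 0 t) hre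
    _ = (κ * duhamel α t f p).re := hH.symm
    _ ≤ ‖κ * duhamel α t f p‖ := Complex.re_le_norm _
    _ = ‖duhamel α t f p‖ := by rw [norm_mul, hκn, one_mul]

end LowerBound

section Weights

/-- The weight defining `H^{s₁,s₂}`. -/
def weight (s₁ s₂ : ℝ) (p : ℝ × ℝ) : ℝ := (1 + p.1 ^ 2) ^ s₁ + (1 + p.2 ^ 2) ^ s₂

theorem weight_pos (s₁ s₂ : ℝ) (p : ℝ × ℝ) : 0 < weight s₁ s₂ p := by
  unfold weight
  positivity

theorem continuous_weight (s₁ s₂ : ℝ) : Continuous (weight s₁ s₂) := by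
  refine Continuous.add ?_ ?_
  · exact Continuous.rpow_const (by fun_prop) fun p => Or.inl (by positivity)
  · exact Continuous.rpow_const (by fun_prop) fun p => Or.inl (by positivity)

theorem rpow_le_four_rpow_abs_mul {x y s : ℝ} (hx : 0 < x) (hy : 0 < y) (h1 : x ≤ 4 * y)
    (h2 : y ≤ 4 * x) : x ^ s ≤ 4 ^ |s| * y ^ s := by
  rcases le_total 0 s with hs | hs
  · rw [abs_of_nonneg hs, ← Real.mul_rpow (by norm_num) hy.le]
    exact Real.rpow_le_rpow hx.le h1 hs
  · rw [abs_of_nonpos hs, Real.rpow_neg (by norm_num), ← Real.inv_rpow (by norm_num),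
      ← Real.mul_rpow (by norm_num) hy.le]
    exact Real.rpow_le_rpow_of_nonpos (by positivity) (by linarith) hs

theorem weight_le {s₁ s₂ : ℝ} {p q : ℝ × ℝ} (h1 : 1 + p.1 ^ 2 ≤ 4 * (1 + q.1 ^ 2))
    (h2 : 1 + q.1 ^ 2 ≤ 4 * (1 + p.1 ^ 2)) (h3 : 1 + p.2 ^ 2 ≤ 4 * (1 + q.2 ^ 2))
    (h4 : 1 + q.2 ^ 2 ≤ 4 * (1 + p.2 ^ 2)) :
    weight s₁ s₂ p ≤ (4 ^ |s₁| + 4 ^ |s₂|) * weight s₁ s₂ q := by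
  have e1 := rpow_le_four_rpow_abs_mul (s := s₁) (by positivity) (by positivity) h1 h2
  have e2 := rpow_le_four_rpow_abs_mul (s := s₂) (by positivity) (by positivity) h3 h4
  have : 0 ≤ (4 : ℝ) ^ |s₁| * (1 + q.2 ^ 2) ^ s₂ := by positivity
  have : 0 ≤ (4 : ℝ) ^ |s₂| * (1 + q.1 ^ 2) ^ s₁ := by positivity
  unfold weight
  linarith

theorem integrable_weight_mul {s₁ s₂ : ℝ} {f : ℝ × ℝ → ℂ} (hf : Continuous f)
    (hs : HasCompactSupport f) : Integrable fun p => weight s₁ s₂ p * ‖f p‖ ^ 2 := by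
  have h1 : HasCompactSupport fun p => ‖f p‖ ^ 2 :=
    hs.comp_left (g := fun z => ‖z‖ ^ 2) (by simp)
  exact ((continuous_weight s₁ s₂).mul (by fun_prop)).integrable_of_hasCompactSupport h1.mul_left

theorem HNorm2_sq (s₁ s₂ : ℝ) (g : ℝ × ℝ → ℂ) :
    HNorm2 s₁ s₂ g ^ 2 = ∫ p, weight s₁ s₂ p * ‖FT2 g p‖ ^ 2 :=
  Real.sq_sqrt (integral_nonneg fun p => mul_nonneg (weight_pos s₁ s₂ p).le (sq_nonneg _))

end Weights

section Counterexample

theorem exists_contDiff_plateau : ∃ ψ : ℝ → ℝ, ContDiff ℝ ∞ ψ ∧ (∀ x, 0 ≤ ψ x) ∧ (∀ x, ψ x ≤ 1) ∧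
    (∀ x ∈ Set.Icc (2 : ℝ) 3, ψ x = 1) ∧ ∀ x, ψ x ≠ 0 → x ∈ Set.Icc (1 : ℝ) 4 := by
  let ψ : ContDiffBump (5 / 2 : ℝ) := ⟨1 / 2, 3 / 2, by norm_num, by norm_num⟩
  refine ⟨ψ, ψ.contDiff, fun x => ψ.nonneg, fun x => ψ.le_one, ?_, ?_⟩
  · intro x hx
    refine ψ.one_of_mem_closedBall ?_
    rw [Real.closedBall_eq_Icc]
    constructor <;> norm_num [ψ] <;> linarith [hx.1, hx.2]
  · intro x hx
    have h : x ∈ Function.support ψ := hx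
    rw [ψ.support_eq, Real.ball_eq_Ioo] at h
    have h1 := h.1
    have h2 := h.2
    norm_num [ψ] at h1 h2
    exact ⟨h1.le, h2.le⟩

/-- A smooth amplitude of height `1` on a low frequency box and `b` on a high frequency box. -/
theorem exists_amplitude {γ δ N η₀ b : ℝ} (hγ : 0 < γ) (hδ : 0 < δ) (hN : 4 * γ < N) (hb : 0 ≤ b) :
    ∃ g : ℝ × ℝ → ℝ, ContDiff ℝ ∞ g ∧ HasCompactSupport g ∧ (∀ q, 0 ≤ g q) ∧
      (∀ q, g q ≠ 0 → q ∈ Set.Icc γ (4 * γ) ×ˢ Set.Icc δ (4 * δ) ∨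
        q ∈ Set.Icc (N + γ) (N + 4 * γ) ×ˢ Set.Icc (η₀ + δ) (η₀ + 4 * δ)) ∧
      (∀ q ∈ Set.Icc γ (4 * γ) ×ˢ Set.Icc δ (4 * δ), g q ≤ 1) ∧
      (∀ q ∈ Set.Icc (N + γ) (N + 4 * γ) ×ˢ Set.Icc (η₀ + δ) (η₀ + 4 * δ), g q ≤ b) ∧
      (∀ q ∈ Set.Icc (2 * γ) (3 * γ) ×ˢ Set.Icc (2 * δ) (3 * δ), 1 ≤ g q) ∧
      ∀ q ∈ Set.Icc (N + 2 * γ) (N + 3 * γ) ×ˢ Set.Icc (η₀ + 2 * δ) (η₀ + 3 * δ), b ≤ g q := by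
  obtain ⟨ψ, hψ, h0, h1, hone, hsupp⟩ := exists_contDiff_plateau
  have hs : ∀ {x c r : ℝ}, 0 < r → ψ ((x - c) / r) ≠ 0 → x ∈ Set.Icc (c + r) (c + 4 * r) := by
    intro x c r hr h
    obtain ⟨k1, k2⟩ := hsupp _ h
    rw [le_div_iff₀ hr] at k1
    rw [div_le_iff₀ hr] at k2
    constructor <;> linarith
  have ho : ∀ {x c r : ℝ}, 0 < r → x ∈ Set.Icc (c + 2 * r) (c + 3 * r) → ψ ((x - c) / r) = 1 := by
    intro x c r hr h
    refine hone _ ⟨?_, ?_⟩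
    · rw [le_div_iff₀ hr]
      linarith [h.1]
    · rw [div_le_iff₀ hr]
      linarith [h.2]
  set L : ℝ × ℝ → ℝ := fun q => ψ ((q.1 - 0) / γ) * ψ ((q.2 - 0) / δ) with hL
  set H : ℝ × ℝ → ℝ := fun q => ψ ((q.1 - N) / γ) * ψ ((q.2 - η₀) / δ) with hH
  have hL0 : ∀ q, 0 ≤ L q := fun q => mul_nonneg (h0 _) (h0 _)
  have hH0 : ∀ q, 0 ≤ H q := fun q => mul_nonneg (h0 _) (h0 _)
  have hL1 : ∀ q, L q ≤ 1 := fun q => mul_le_one₀ (h1 _) (h0 _) (h1 _)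
  have hH1 : ∀ q, H q ≤ 1 := fun q => mul_le_one₀ (h1 _) (h0 _) (h1 _)
  have hLs : ∀ q, L q ≠ 0 → q ∈ Set.Icc γ (4 * γ) ×ˢ Set.Icc δ (4 * δ) := by
    intro q hq
    have := hs hγ (left_ne_zero_of_mul hq)
    have := hs hδ (right_ne_zero_of_mul hq)
    simp only [zero_add] at *
    exact ⟨by assumption, by assumption⟩
  have hHs : ∀ q, H q ≠ 0 →
      q ∈ Set.Icc (N + γ) (N + 4 * γ) ×ˢ Set.Icc (η₀ + δ) (η₀ + 4 * δ) := fun q hq =>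
    ⟨hs hγ (left_ne_zero_of_mul hq), hs hδ (right_ne_zero_of_mul hq)⟩
  have hgs : ∀ q, L q + b * H q ≠ 0 → q ∈ Set.Icc γ (4 * γ) ×ˢ Set.Icc δ (4 * δ) ∨
        q ∈ Set.Icc (N + γ) (N + 4 * γ) ×ˢ Set.Icc (η₀ + δ) (η₀ + 4 * δ) := by
    intro q hq
    by_cases h : L q = 0
    · refine Or.inr (hHs q fun h' => hq ?_)
      rw [h, h', mul_zero, add_zero]
    · exact Or.inl (hLs q h)
  refine ⟨fun q => L q + b * H q, ?_, ?_, ?_, hgs, ?_, ?_, ?_, ?_⟩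
  · have e : ∀ c r : ℝ, ContDiff ℝ ∞ fun x => ψ ((x - c) / r) := fun c r =>
      hψ.comp (by fun_prop)
    exact (((e 0 γ).comp contDiff_fst).mul ((e 0 δ).comp contDiff_snd)).add
      (contDiff_const.mul (((e N γ).comp contDiff_fst).mul ((e η₀ δ).comp contDiff_snd)))
  · have hK : IsCompact (Set.Icc γ (4 * γ) ×ˢ Set.Icc δ (4 * δ) ∪
        Set.Icc (N + γ) (N + 4 * γ) ×ˢ Set.Icc (η₀ + δ) (η₀ + 4 * δ)) :=
      (isCompact_Icc.prod isCompact_Icc).union (isCompact_Icc.prod isCompact_Icc)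
    refine HasCompactSupport.intro hK fun q hq => ?_
    by_contra h
    exact hq (hgs q h)
  · exact fun q => add_nonneg (hL0 q) (mul_nonneg hb (hH0 q))
  · intro q hq
    have : H q = 0 := by
      by_contra h
      linarith [(hHs q h).1.1, hq.1.2]
    simp only [this, mul_zero, add_zero]
    exact hL1 q
  · intro q hq
    have : L q = 0 := by
      by_contra h
      linarith [(hLs q h).1.2, hq.1.1]
    simp only [this, zero_add]
    exact mul_le_of_le_one_right hb (hH1 q)
  · intro q hq
    have : L q = 1 := by
      simp only [hL]
      rw [ho hγ (by simpa using hq.1), ho hδ (by simpa using hq.2), one_mul]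
    simp only [this]
    exact le_add_of_nonneg_right (mul_nonneg hb (hH0 q))
  · intro q hq
    have : H q = 1 := by
      simp only [hH]
      rw [ho hγ hq.1, ho hδ hq.2, one_mul]
    simp only [this, mul_one]
    exact le_add_of_nonneg_left (hL0 q)

theorem weight_le_near {s₁ s₂ N η₀ : ℝ} {p : ℝ × ℝ} (hN : 2 ≤ N) (hη : 1 ≤ η₀) (h1 : N ≤ p.1)
    (h2 : p.1 ≤ N + 2) (h3 : η₀ ≤ p.2) (h4 : p.2 ≤ η₀ + 1 / 2) :
    weight s₁ s₂ p ≤ (4 ^ |s₁| + 4 ^ |s₂|) * weight s₁ s₂ (N, η₀) ∧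
      weight s₁ s₂ (N, η₀) ≤ (4 ^ |s₁| + 4 ^ |s₂|) * weight s₁ s₂ p := by
  have e1 : 1 + p.1 ^ 2 ≤ 4 * (1 + N ^ 2) := by nlinarith
  have e2 : 1 + N ^ 2 ≤ 4 * (1 + p.1 ^ 2) := by nlinarith
  have e3 : 1 + p.2 ^ 2 ≤ 4 * (1 + η₀ ^ 2) := by nlinarith
  have e4 : 1 + η₀ ^ 2 ≤ 4 * (1 + p.2 ^ 2) := by nlinarith
  exact ⟨weight_le e1 e2 e3 e4, weight_le e2 e1 e4 e3⟩

theorem weight_le_low {s₁ s₂ : ℝ} {p : ℝ × ℝ} (h1 : |p.1| ≤ 1) (h2 : |p.2| ≤ 1) :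
    weight s₁ s₂ p ≤ 4 ^ |s₁| + 4 ^ |s₂| := by
  have k1 : p.1 ^ 2 ≤ 1 := (sq_le_one_iff_abs_le_one _).2 h1
  have k2 : p.2 ^ 2 ≤ 1 := (sq_le_one_iff_abs_le_one _).2 h2
  have e1 := rpow_le_four_rpow_abs_mul (x := 1 + p.1 ^ 2) (y := 1) (s := s₁) (by positivity)
    one_pos (by linarith) (by nlinarith)
  have e2 := rpow_le_four_rpow_abs_mul (x := 1 + p.2 ^ 2) (y := 1) (s := s₂) (by positivity)
    one_pos (by linarith) (by nlinarith)
  rw [Real.one_rpow, mul_one] at e1 e2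
  exact add_le_add e1 e2

/-- Data on which the bilinear Duhamel estimate loses a factor `N² γ δ`. -/
theorem Scales.exists_datum {α N γ δ η₀ : ℝ} (S : Scales α N γ δ η₀) (s₁ s₂ : ℝ) {t : ℝ}
    (ht : 0 ≤ t) (htR : t * (600 + 200 / (-α)) ≤ 1) :
    ∃ f : ℝ × ℝ → ℂ, ContDiff ℝ ∞ f ∧ HasCompactSupport f ∧ (∀ q, f q ≠ 0 → γ ≤ q.1) ∧
      ∫ p, weight s₁ s₂ p * ‖f p‖ ^ 2 ≤ 18 * (4 ^ |s₁| + 4 ^ |s₂|) * (γ * δ) ∧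
      (t * N) ^ 2 * (γ * δ) ^ 3 ≤
        64 * (4 ^ |s₁| + 4 ^ |s₂|) * ∫ p, weight s₁ s₂ p * ‖duhamel α t f p‖ ^ 2 := by
  have hγ := S.γ_pos
  have hδ := S.δ_pos
  have hγ4 := S.γ_le
  have hδ4 := S.δ_le
  have hN := S.le_N
  have hη := S.N_le_η
  set K : ℝ := 4 ^ |s₁| + 4 ^ |s₂| with hK
  have hK0 : 0 < K := by positivity
  set W := weight s₁ s₂ (N, η₀) with hW
  have hW0 : 0 < W := weight_pos _ _ _
  set b := (Real.sqrt W)⁻¹ with hb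
  have hb0 : 0 < b := inv_pos.2 (Real.sqrt_pos.2 hW0)
  have hbW : W * b ^ 2 = 1 := by
    rw [hb, inv_pow, Real.sq_sqrt hW0.le, mul_inv_cancel₀ hW0.ne']
  obtain ⟨g, hg, hgs, hg0, hsupp, hlow, hhigh, hone, hbb⟩ :=
    exists_amplitude (N := N) (η₀ := η₀) hγ hδ (by linarith) hb0.le
  have hgc : ∀ q, g q ≠ 0 → γ ≤ q.1 := by
    intro q hq
    rcases hsupp q hq with h | h
    · exact h.1.1
    · linarith [h.1.1]
  have hf : ContDiff ℝ ∞ fun q => (g q : ℂ) := Complex.ofRealCLM.contDiff.comp hg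
  have hfs : HasCompactSupport fun q => (g q : ℂ) := hgs.comp_left Complex.ofReal_zero
  have hfc : ∀ q, (g q : ℂ) ≠ 0 → γ ≤ q.1 := fun q hq => hgc q (by simpa using hq)
  refine ⟨fun q => (g q : ℂ), hf, hfs, hfc, ?_, ?_⟩
  · set A : Set (ℝ × ℝ) := Set.Icc γ (4 * γ) ×ˢ Set.Icc δ (4 * δ) with hA
    set B : Set (ℝ × ℝ) := Set.Icc (N + γ) (N + 4 * γ) ×ˢ Set.Icc (η₀ + δ) (η₀ + 4 * δ) with hB
    have hAm : MeasurableSet A := measurableSet_Icc.prod measurableSet_Icc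
    have hBm : MeasurableSet B := measurableSet_Icc.prod measurableSet_Icc
    have hAi : Integrable (A.indicator fun _ => K) :=
      (integrable_indicator_iff hAm).2 (integrableOn_const (volume_Icc_prod_ne_top _ _ _ _))
    have hBi : Integrable (B.indicator fun _ => K) :=
      (integrable_indicator_iff hBm).2 (integrableOn_const (volume_Icc_prod_ne_top _ _ _ _))
    have hA0 : ∀ q, 0 ≤ A.indicator (fun _ => K) q := fun q =>
      Set.indicator_nonneg (fun _ _ => hK0.le) q
    have hB0 : ∀ q, 0 ≤ B.indicator (fun _ => K) q := fun q =>
      Set.indicator_nonneg (fun _ _ => hK0.le) q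
    calc ∫ p, weight s₁ s₂ p * ‖(g p : ℂ)‖ ^ 2
        ≤ ∫ p, (A.indicator (fun _ => K) p + B.indicator (fun _ => K) p) := by
          refine integral_mono (integrable_weight_mul hf.continuous hfs) (hAi.add hBi) fun q => ?_
          simp only [Complex.norm_real, Real.norm_eq_abs, sq_abs]
          have hw := (weight_pos s₁ s₂ q).le
          by_cases hq : g q = 0
          · rw [hq]
            have := hA0 q
            have := hB0 q
            simp only [ne_eq, OfNat.ofNat_ne_zero, not_false_eq_true, zero_pow, mul_zero]
            linarith
          rcases hsupp q hq with h | h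
          · refine le_trans ?_ (le_add_of_nonneg_right (hB0 q))
            rw [Set.indicator_of_mem h]
            have h1 : weight s₁ s₂ q ≤ K := by
              refine weight_le_low ?_ ?_
              · rw [abs_of_nonneg (hγ.le.trans h.1.1)]
                linarith [h.1.2]
              · rw [abs_of_nonneg (hδ.le.trans h.2.1)]
                linarith [h.2.2]
            have h2 : g q ^ 2 ≤ 1 := pow_le_one₀ (hg0 q) (hlow q h)
            exact (mul_le_of_le_one_right hw h2).trans h1
          · refine le_trans ?_ (le_add_of_nonneg_left (hA0 q))
            rw [Set.indicator_of_mem h]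
            have h1 : weight s₁ s₂ q ≤ K * W :=
              (weight_le_near (by linarith) (by linarith) (by linarith [h.1.1])
                (by linarith [h.1.2]) (by linarith [h.2.1]) (by linarith [h.2.2])).1
            have h2 : g q ^ 2 ≤ b ^ 2 := pow_le_pow_left₀ (hg0 q) (hhigh q h) 2
            calc weight s₁ s₂ q * g q ^ 2 ≤ K * W * b ^ 2 :=
                  mul_le_mul h1 h2 (sq_nonneg _) (by positivity)
              _ = K := by rw [mul_assoc, hbW, mul_one]
      _ = 18 * K * (γ * δ) := by
          rw [integral_add hAi hBi, integral_indicator hAm, integral_indicator hBm,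
            setIntegral_const, setIntegral_const, hA, hB,
            volume_real_Icc_prod (by linarith) (by linarith),
            volume_real_Icc_prod (by linarith) (by linarith), smul_eq_mul, smul_eq_mul]
          ring
  · obtain ⟨-, hdc, hds⟩ := FT2_duhamel (α := α) t hγ hf hfs hfc
    set P : Set (ℝ × ℝ) := Set.Icc (N + 19 / 4 * γ) (N + 21 / 4 * γ) ×ˢ
      Set.Icc (η₀ + 19 / 4 * δ) (η₀ + 21 / 4 * δ) with hP
    set B : Set (ℝ × ℝ) := Set.Icc (9 / 4 * γ) (11 / 4 * γ) ×ˢ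
      Set.Icc (9 / 4 * δ) (11 / 4 * δ) with hB
    have hPm : MeasurableSet P := measurableSet_Icc.prod measurableSet_Icc
    have hBv : volume.real B = γ * δ / 4 := by
      rw [hB, volume_real_Icc_prod (by linarith) (by linarith)]
      ring
    have hlower : ∀ p ∈ P, t * N * b * (γ * δ) / 4 ≤
        ‖duhamel α t (fun q => (g q : ℂ)) p‖ := by
      intro p hp
      have hp1 := hp.1.1
      have hp2 := hp.1.2
      have hp3 := hp.2.1
      have hp4 := hp.2.2
      refine le_trans ?_ (le_norm_duhamel (m := N * b) (B := B) ht hγ hg hgs hgc hg0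
        (measurableSet_Icc.prod measurableSet_Icc) (volume_Icc_prod_ne_top _ _ _ _) ?_ ?_)
      · rw [hBv]
        have h1 : 0 ≤ t * N * b * (γ * δ) / 4 := by positivity
        have h2 : (1 : ℝ) ≤ Real.pi := by linarith [Real.pi_gt_three]
        calc t * N * b * (γ * δ) / 4 ≤ Real.pi * (t * N * b * (γ * δ) / 4) :=
              le_mul_of_one_le_left h1 h2
          _ = Real.pi * (N * b) * (γ * δ / 4) * t := by ring
      · intro q hq hpq
        refine le_trans (mul_le_mul_of_nonneg_left ?_ ht) htR
        have e1 : (p - q).1 = p.1 - q.1 := rfl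
        have e2 : (p - q).2 = p.2 - q.2 := rfl
        rcases hsupp q hq with h | h <;> rcases hsupp _ hpq with h' | h' <;>
          obtain ⟨⟨a1, a2⟩, a3, a4⟩ := h <;> obtain ⟨⟨b1, b2⟩, b3, b4⟩ := h'
        · linarith
        · have := S.resonance (q := q) (r := p - q) a1 a2 (hδ.le.trans a3) a4 (by linarith) b2
            (by linarith) b4
          rwa [add_sub_cancel] at this
        · have := S.resonance (q := p - q) (r := q) b1 b2 (hδ.le.trans b3) b4 (by linarith) a2
            (by linarith) a4
          rwa [sub_add_cancel, sub_right_comm] at this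
        · linarith
      · intro q hq
        have e1 : (p - q).1 = p.1 - q.1 := rfl
        obtain ⟨⟨a1, a2⟩, a3, a4⟩ := hq
        have h1 : 1 ≤ g q := hone q
          ⟨⟨by linarith, by linarith⟩, by linarith, by linarith⟩
        have h2 : b ≤ g (p - q) := hbb (p - q)
          ⟨⟨by simp only [Prod.fst_sub]; linarith, by simp only [Prod.fst_sub]; linarith⟩,
            by simp only [Prod.snd_sub]; linarith, by simp only [Prod.snd_sub]; linarith⟩
        have h3 : N ≤ (p - q).1 := by linarith
        have h4 : N * b ≤ (p - q).1 * g (p - q) := mul_le_mul h3 h2 hb0.le (by linarith)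
        exact h4.trans (le_mul_of_one_le_left ((mul_nonneg (by linarith) hb0.le).trans h4) h1)
    have hint := integrable_weight_mul (s₁ := s₁) (s₂ := s₂) hdc hds
    have hnn : ∀ p, 0 ≤ weight s₁ s₂ p * ‖duhamel α t (fun q => (g q : ℂ)) p‖ ^ 2 := fun p =>
      mul_nonneg (weight_pos _ _ _).le (sq_nonneg _)
    have hconst : ∀ p ∈ P, (t * N * (γ * δ)) ^ 2 / (16 * K) ≤
        weight s₁ s₂ p * ‖duhamel α t (fun q => (g q : ℂ)) p‖ ^ 2 := by
      intro p hp
      have h1 : W ≤ K * weight s₁ s₂ p :=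
        (weight_le_near (by linarith) (by linarith) (by linarith [hp.1.1])
          (by linarith [hp.1.2]) (by linarith [hp.2.1]) (by linarith [hp.2.2])).2
      have h2 := pow_le_pow_left₀ (by positivity) (hlower p hp) 2
      have h3 : W / K ≤ weight s₁ s₂ p := by
        rw [div_le_iff₀ hK0]
        linarith
      calc (t * N * (γ * δ)) ^ 2 / (16 * K)
          = W / K * (t * N * b * (γ * δ) / 4) ^ 2 := by
            rw [show W / K * (t * N * b * (γ * δ) / 4) ^ 2 =
              (W * b ^ 2) * ((t * N * (γ * δ)) ^ 2 / (16 * K)) by field_simp; ring, hbW, one_mul]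
        _ ≤ _ := mul_le_mul h3 h2 (sq_nonneg _) (weight_pos _ _ _).le
    have hPv : volume.real P = γ * δ / 4 := by
      rw [hP, volume_real_Icc_prod (by linarith) (by linarith)]
      ring
    have hfinal : (γ * δ / 4) * ((t * N * (γ * δ)) ^ 2 / (16 * K)) ≤
        ∫ p, weight s₁ s₂ p * ‖duhamel α t (fun q => (g q : ℂ)) p‖ ^ 2 := by
      calc (γ * δ / 4) * ((t * N * (γ * δ)) ^ 2 / (16 * K))
          = ∫ _ in P, (t * N * (γ * δ)) ^ 2 / (16 * K) := by
            rw [setIntegral_const, hPv, smul_eq_mul]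
        _ ≤ ∫ p in P, weight s₁ s₂ p * ‖duhamel α t (fun q => (g q : ℂ)) p‖ ^ 2 :=
            setIntegral_mono_on (integrableOn_const (volume_Icc_prod_ne_top _ _ _ _))
              hint.integrableOn hPm hconst
        _ ≤ _ := setIntegral_le_integral hint (Eventually.of_forall hnn)
    calc (t * N) ^ 2 * (γ * δ) ^ 3
        = 64 * K * ((γ * δ / 4) * ((t * N * (γ * δ)) ^ 2 / (16 * K))) := by
          field_simp
          ring
      _ ≤ _ := mul_le_mul_of_nonneg_left hfinal (by positivity)

end Counterexample

theorem stmt19 (s₁ s₂ α T : ℝ) (hα1 : -1 ≤ α) (hα2 : α < 0) (hT : 0 < T)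
    (X : Type*) [NormedAddCommGroup X] [NormedSpace ℝ X] [CompleteSpace X]
    (ι : X →ₗ[ℝ] (ℝ → ℝ × ℝ → ℂ)) (C : ℝ) :
    ¬ (0 < C ∧
      (∀ u : X, ∀ t ∈ Set.Icc (-T) T, HNorm2 s₁ s₂ (ι u t) ≤ C * ‖u‖) ∧
      (∀ φ : ℝ × ℝ → ℂ, MemH s₁ s₂ φ →
        ∃ uφ : X, (∀ t : ℝ, ι uφ t = Wgrp α t φ) ∧ ‖uφ‖ ≤ C * HNorm2 s₁ s₂ φ) ∧
      (∀ u : X, ∃ v : X,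
        (∀ t : ℝ, ∀ z : ℝ × ℝ,
          ι v t z =
            ∫ t' in (0 : ℝ)..t,
              Wgrp α (t - t')
                (fun w => ι u t' w * deriv (fun a => ι u t' (a, w.2)) w.1) z) ∧
        ‖v‖ ≤ C * ‖u‖ ^ 2)) := by
  rintro ⟨hC, hbound, hlin, hbil⟩
  set K : ℝ := 4 ^ |s₁| + 4 ^ |s₂| with hK
  have hK0 : 0 < K := by positivity
  set R : ℝ := 600 + 200 / (-α) with hR
  have hα : 0 < -α := by linarith
  have hR0 : 0 < R := by positivity
  set t : ℝ := min T (1 / R) with ht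
  have ht0 : 0 < t := lt_min hT (by positivity)
  have htR : t * R ≤ 1 := by
    rw [← le_div_iff₀ hR0]
    exact min_le_right _ _
  have htT : t ∈ Set.Icc (-T) T := ⟨by linarith, min_le_left _ _⟩
  set Λ : ℝ := 64 * K * (C ^ 4 * (18 * K)) ^ 2 / t ^ 2 with hΛ
  obtain ⟨N, hN, hNΛ⟩ : ∃ N : ℝ, 16 ≤ N ∧ 3 * Λ ^ 2 / (-α) < N ^ (-α) :=
    ((eventually_ge_atTop (16 : ℝ)).and
      ((tendsto_rpow_atTop hα).eventually_gt_atTop _)).exists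
  obtain ⟨γ, δ, η₀, S⟩ := Scales.exists_scales hα1 hα2 hN
  have hγ := S.γ_pos
  have hδ := S.δ_pos
  obtain ⟨f, hf, hfs, hfc, hup, hlow⟩ := S.exists_datum s₁ s₂ ht0.le htR
  have hFT : FT2 (IFT2 f) = f := FT2_IFT2 hf hfs
  have hmem : MemH s₁ s₂ (IFT2 f) := by
    rw [MemH, hFT]
    exact integrable_weight_mul hf.continuous hfs
  obtain ⟨u, hu, hun⟩ := hlin _ hmem
  obtain ⟨v, hv, hvn⟩ := hbil u
  have hφ : HNorm2 s₁ s₂ (IFT2 f) ^ 2 ≤ 18 * K * (γ * δ) := by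
    rw [HNorm2_sq, hFT]
    exact hup
  have hvt : FT2 (ι v t) = duhamel α t f := by
    rw [← (FT2_duhamel (α := α) t hγ hf hfs hfc).1]
    congr 1
    funext z
    rw [hv]
    simp only [hu]
  have hv2 : HNorm2 s₁ s₂ (ι v t) ^ 2 = ∫ p, weight s₁ s₂ p * ‖duhamel α t f p‖ ^ 2 := by
    rw [HNorm2_sq, hvt]
  have hle : HNorm2 s₁ s₂ (ι v t) ≤ C ^ 4 * (18 * K * (γ * δ)) :=
    calc HNorm2 s₁ s₂ (ι v t) ≤ C * ‖v‖ := hbound v t htT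
      _ ≤ C * (C * ‖u‖ ^ 2) := by gcongr
      _ ≤ C * (C * (C * HNorm2 s₁ s₂ (IFT2 f)) ^ 2) := by gcongr
      _ = C ^ 4 * HNorm2 s₁ s₂ (IFT2 f) ^ 2 := by ring
      _ ≤ C ^ 4 * (18 * K * (γ * δ)) := by gcongr
  have hH0 : 0 ≤ HNorm2 s₁ s₂ (ι v t) := Real.sqrt_nonneg _
  have hsq := pow_le_pow_left₀ hH0 hle 2
  rw [hv2] at hsq
  have hgain : N ^ 2 * (γ * δ) ≤ Λ := by
    rw [hΛ, le_div_iff₀ (by positivity)]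
    refine le_of_mul_le_mul_right ?_ (by positivity : 0 < (γ * δ) ^ 2)
    calc N ^ 2 * (γ * δ) * t ^ 2 * (γ * δ) ^ 2 = (t * N) ^ 2 * (γ * δ) ^ 3 := by ring
      _ ≤ 64 * K * (C ^ 4 * (18 * K * (γ * δ))) ^ 2 :=
          hlow.trans (mul_le_mul_of_nonneg_left hsq (by positivity))
      _ = 64 * K * (C ^ 4 * (18 * K)) ^ 2 * (γ * δ) ^ 2 := by ring
  have hgain2 := pow_le_pow_left₀ (by positivity) hgain 2
  have := S.gain_sq
  rw [div_lt_iff₀ hα] at hNΛ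
  linarith
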